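/- Let 0 < α < π, let K̂_α(z) = sin((π−α)z)/sin(πz), and fix a cut-off function φ: a nonincreasing C^∞ function on [0,∞) with φ ≡ 1 on a neighborhood of 0 and φ ≡ 0 on [1,∞). Suppose λ ∈ ℂ does not belong to the closure of the set {K̂_α(−1/2 + it) : t ∈ ℝ} and λ ≠ 1 − α/π. Then for every g of the form g = b φ + g₀, where b ∈ ℂ and g₀ is locally absolutely continuous on (0,∞) with ∫₀^∞ |g₀(s)|² s^{−2} ds < ∞ and ∫₀^∞ |g₀'(s)|² ds < ∞, there exist a unique a ∈ ℂ and a unique h, locally absolutely continuous on (0,∞) with ∫₀^∞ |h(s)|² s^{−2} ds < ∞ and ∫₀^∞ |h'(s)|² ds < ∞, such that f = a φ + h satisfies K_α f(s) − λ f(s) = g(s) for almost every s > 0. -/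

import Mathlib

open MeasureTheory Set

section

open scoped FourierTransform

lemma integral_fourier_mul_comm {f g : ℝ → ℂ} (hf : Integrable f) (hg : Integrable g) :
    ∫ x, 𝓕 f x * g x = ∫ x, f x * 𝓕 g x := by
  simpa using! (VectorFourier.integral_fourierIntegral_smul_eq_flip (L := innerₗ ℝ)
    (μ := volume) (ν := volume)
    Real.continuous_fourierChar continuous_inner hf hg)

lemma integral_fourierInv_mul_comm {f g : ℝ → ℂ} (hf : Integrable f) (hg : Integrable g) :
    ∫ x, 𝓕⁻ f x * g x = ∫ x, f x * 𝓕⁻ g x := by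
  have h := integral_fourier_mul_comm hf hg.comp_neg
  rw [Real.fourierInv_eq_fourier_comp_neg g, ← h, ← integral_neg_eq_self]
  simp [Real.fourierInv_eq_fourier_neg]

lemma fourier_toLp_ae_eq {f : ℝ → ℂ} (h1 : Integrable f) (h2 : MemLp f 2) :
    (𝓕 (h2.toLp f) : Lp ℂ 2 (volume : Measure ℝ)) =ᵐ[volume] 𝓕 f := by
  refine ae_eq_of_integral_contDiff_smul_eq ((Lp.memLp _).locallyIntegrable (by norm_num)) ?_ ?_
  · exact (VectorFourier.fourierIntegral_continuous Real.continuous_fourierChar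
      (by exact continuous_inner) h1).locallyIntegrable
  intro g hg hc
  have hc' : HasCompactSupport (fun x => (g x : ℂ)) := hc.comp_left (g := fun r : ℝ => (r : ℂ)) rfl
  let G := hc'.toSchwartzMap (Complex.ofRealCLM.contDiff.comp hg)
  have h := congrArg (fun T => T G) (Lp.fourier_toTemperedDistribution_eq (h2.toLp f))
  simp only [TemperedDistribution.fourier_apply, Lp.toTemperedDistribution_apply] at h
  have hGg : ∀ x, G x = g x := fun x => rfl
  simp only [hGg, smul_eq_mul] at h
  simp only [Complex.real_smul]
  rw [← h]
  have := integral_fourier_mul_comm (f := G) G.integrable h1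
  simp only [hGg] at this
  rw [← this]
  apply integral_congr_ae
  filter_upwards [h2.coeFn_toLp] with x hx
  rw [hx, SchwartzMap.fourier_coe]

lemma fourierInv_toLp_ae_eq {f : ℝ → ℂ} (h1 : Integrable f) (h2 : MemLp f 2) :
    (𝓕⁻ (h2.toLp f) : Lp ℂ 2 (volume : Measure ℝ)) =ᵐ[volume] 𝓕⁻ f := by
  refine ae_eq_of_integral_contDiff_smul_eq ((Lp.memLp _).locallyIntegrable (by norm_num)) ?_ ?_
  · rw [Real.fourierInv_eq_fourier_comp_neg f]
    exact (VectorFourier.fourierIntegral_continuous Real.continuous_fourierChar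
      (by exact continuous_inner) h1.comp_neg).locallyIntegrable
  intro g hg hc
  have hc' : HasCompactSupport (fun x => (g x : ℂ)) := hc.comp_left (g := fun r : ℝ => (r : ℂ)) rfl
  let G := hc'.toSchwartzMap (Complex.ofRealCLM.contDiff.comp hg)
  have h := congrArg (fun T => T G) (Lp.fourierInv_toTemperedDistribution_eq (h2.toLp f))
  simp only [TemperedDistribution.fourierInv_apply, Lp.toTemperedDistribution_apply] at h
  have hGg : ∀ x, G x = g x := fun x => rfl
  simp only [hGg, smul_eq_mul] at h
  simp only [Complex.real_smul]
  rw [← h]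
  have := integral_fourierInv_mul_comm (f := G) G.integrable h1
  simp only [hGg] at this
  rw [← this]
  apply integral_congr_ae
  filter_upwards [h2.coeFn_toLp] with x hx
  rw [hx, SchwartzMap.fourierInv_coe]

/-- `F` represents the `L²` Fourier transform of the square integrable function `f`. -/
def IsFourierPair (f F : ℝ → ℂ) : Prop :=
  ∃ hf : MemLp f 2 (volume : Measure ℝ),
    (𝓕 (hf.toLp f) : Lp ℂ 2 (volume : Measure ℝ)) =ᵐ[volume] F

namespace IsFourierPair

lemma memLp {f F : ℝ → ℂ} (h : IsFourierPair f F) : MemLp f 2 := h.1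

lemma memLp_right {f F : ℝ → ℂ} (h : IsFourierPair f F) : MemLp F 2 :=
  (memLp_congr_ae h.2).1 (Lp.memLp _)

lemma congr_left {f g F : ℝ → ℂ} (h : IsFourierPair f F) (hfg : f =ᵐ[volume] g) :
    IsFourierPair g F := by
  obtain ⟨hf, hF⟩ := h
  refine ⟨(memLp_congr_ae hfg).1 hf, ?_⟩
  rwa [← (MemLp.toLp_eq_toLp_iff hf _).2 hfg]

lemma congr_right {f F G : ℝ → ℂ} (h : IsFourierPair f F) (hFG : F =ᵐ[volume] G) :
    IsFourierPair f G := ⟨h.1, h.2.trans hFG⟩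

lemma exists_right {f : ℝ → ℂ} (hf : MemLp f 2) : ∃ F, IsFourierPair f F := ⟨_, hf, ae_eq_rfl⟩

lemma exists_left {F : ℝ → ℂ} (hF : MemLp F 2) : ∃ f, IsFourierPair f F := by
  refine ⟨(𝓕⁻ (hF.toLp F) : Lp ℂ 2 (volume : Measure ℝ)), Lp.memLp _, ?_⟩
  rw [Lp.toLp_coeFn, FourierTransform.fourier_fourierInv_eq]
  exact hF.coeFn_toLp

lemma ae_eq {f g F : ℝ → ℂ} (hf : IsFourierPair f F) (hg : IsFourierPair g F) :
    f =ᵐ[volume] g := by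
  obtain ⟨hf, hF⟩ := hf
  obtain ⟨hg, hG⟩ := hg
  have : (𝓕 (hf.toLp f) : Lp ℂ 2 (volume : Measure ℝ)) = 𝓕 (hg.toLp g) :=
    Lp.ext (hF.trans hG.symm)
  exact (MemLp.toLp_eq_toLp_iff hf hg).1 ((Lp.fourierTransformₗᵢ ℝ ℂ).injective this)

lemma const_mul {f F : ℝ → ℂ} (h : IsFourierPair f F) (c : ℂ) :
    IsFourierPair (fun x => c * f x) (fun x => c * F x) := by
  obtain ⟨hf, hF⟩ := h
  refine ⟨hf.const_mul c, ?_⟩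
  have : (hf.const_mul c).toLp (fun x => c * f x) = c • hf.toLp f := rfl
  rw [this, FourierTransform.fourier_smul]
  filter_upwards [Lp.coeFn_smul c (𝓕 (hf.toLp f)), hF] with x h1 h2
  rw [h1, Pi.smul_apply, h2, smul_eq_mul]

lemma sub {f F g G : ℝ → ℂ} (h : IsFourierPair f F) (h' : IsFourierPair g G) :
    IsFourierPair (fun x => f x - g x) (fun x => F x - G x) := by
  obtain ⟨hf, hF⟩ := h
  obtain ⟨hg, hG⟩ := h'
  refine ⟨hf.sub hg, ?_⟩
  have : (hf.sub hg).toLp (fun x => f x - g x) = hf.toLp f - hg.toLp g := rfl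
  have h2 : (𝓕 (hf.toLp f - hg.toLp g) : Lp ℂ 2 (volume : Measure ℝ)) =
    𝓕 (hf.toLp f) - 𝓕 (hg.toLp g) := (Lp.fourierTransformₗᵢ ℝ ℂ).map_sub _ _
  rw [this, h2]
  filter_upwards [Lp.coeFn_sub (𝓕 (hf.toLp f)) (𝓕 (hg.toLp g)), hF, hG] with x h1 h2 h3
  rw [h1, Pi.sub_apply, h2, h3]

end IsFourierPair

lemma continuous_fourier {κ : ℝ → ℂ} (h1 : Integrable κ) : Continuous (𝓕 κ) :=
  VectorFourier.fourierIntegral_continuous Real.continuous_fourierChar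
    (by exact continuous_inner) h1

lemma norm_fourier_le (κ : ℝ → ℂ) (ξ : ℝ) : ‖𝓕 κ ξ‖ ≤ ∫ x, ‖κ x‖ :=
  VectorFourier.norm_fourierIntegral_le_integral_norm _ _ _ _ _

lemma fourier_conj_reflect (κ : ℝ → ℂ) (x ξ : ℝ) :
    𝓕 (fun y => (starRingEnd ℂ) (κ (x - y))) ξ =
      (starRingEnd ℂ) (Real.fourierChar (ξ * x) * 𝓕 κ ξ) := by
  rw [Real.fourier_real_eq, Real.fourier_real_eq, ← integral_const_mul, ← integral_conj,
    ← integral_sub_left_eq_self _ volume x]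
  congr 1
  ext y
  simp only [Circle.smul_def, smul_eq_mul, map_mul, sub_sub_cancel, ← mul_assoc]
  congr 1
  simp only [← Circle.coe_inv_eq_conj, ← AddChar.map_neg_eq_inv, ← Circle.coe_mul,
    ← AddChar.map_add_eq_mul]
  congr 2
  ring

lemma IsFourierPair.convolution {f F κ : ℝ → ℂ} (hf : IsFourierPair f F) (h1 : Integrable κ)
    (h2 : MemLp κ 2) : IsFourierPair (fun x => ∫ y, κ (x - y) * f y) (fun ξ => 𝓕 κ ξ * F ξ) := by
  have hF := hf.memLp_right
  have hm2 : MemLp (fun ξ => 𝓕 κ ξ * F ξ) 2 :=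
    hF.of_le_mul (c := ∫ x, ‖κ x‖)
      ((continuous_fourier h1).aestronglyMeasurable.mul hF.1) (Filter.Eventually.of_forall
        fun ξ => by rw [norm_mul]; gcongr; exact norm_fourier_le κ ξ)
  have hκ2 : MemLp (𝓕 κ) 2 := (memLp_congr_ae (fourier_toLp_ae_eq h1 h2)).1 (Lp.memLp _)
  have hm1 : Integrable (fun ξ => 𝓕 κ ξ * F ξ) := hκ2.integrable_mul hF
  have key : (fun x => ∫ y, κ (x - y) * f y) = 𝓕⁻ (fun ξ => 𝓕 κ ξ * F ξ) := by
    ext x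
    have p1 : Integrable (fun y => (starRingEnd ℂ) (κ (x - y))) :=
      (Complex.conjLIE.toContinuousLinearEquiv : ℂ →L[ℝ] ℂ).integrable_comp (h1.comp_sub_left x)
    have p2 : MemLp (fun y => (starRingEnd ℂ) (κ (x - y))) 2 :=
      (Complex.conjLIE.toContinuousLinearEquiv : ℂ →L[ℝ] ℂ).comp_memLp'
        (h2.comp_measurePreserving (Measure.measurePreserving_sub_left volume x))
    have hin := Lp.inner_fourier_eq (p2.toLp _) (hf.1.toLp f)
    rw [L2.inner_def, L2.inner_def] at hin
    calc _ = ∫ y, inner ℂ (p2.toLp _ y) (hf.1.toLp f y) := by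
          apply integral_congr_ae
          filter_upwards [p2.coeFn_toLp, hf.1.coeFn_toLp] with y e1 e2
          rw [e1, e2]
          simp [mul_comm]
      _ = _ := hin.symm
      _ = _ := by
          rw [Real.fourierInv_eq]
          apply integral_congr_ae
          filter_upwards [fourier_toLp_ae_eq p1 p2, hf.2] with ξ e1 e2
          rw [e1, e2, fourier_conj_reflect]
          simp only [Circle.smul_def, RCLike.inner_apply, Complex.conj_conj, smul_eq_mul,
            RCLike.inner_apply, conj_trivial, mul_comm ξ x]
          ring
  rw [key]
  refine IsFourierPair.congr_left ⟨Lp.memLp (𝓕⁻ (hm2.toLp _)), ?_⟩ (fourierInv_toLp_ae_eq hm1 hm2)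
  rw [Lp.toLp_coeFn, FourierTransform.fourier_fourierInv_eq]
  exact hm2.coeFn_toLp

lemma exists_convolution_eq {κ : ℝ → ℂ} (h1 : Integrable κ) (h2 : MemLp κ 2) {lam : ℂ} {δ : ℝ}
    (hδ : 0 < δ) (hlam : ∀ ξ, δ ≤ ‖𝓕 κ ξ - lam‖) {U : ℝ → ℂ} (hU : MemLp U 2) :
    ∃ W : ℝ → ℂ, MemLp W 2 ∧ ∀ j : ℝ → ℂ, Integrable j → MemLp j 2 →
      ∀ᵐ x, (∫ y, κ (x - y) * ∫ z, j (y - z) * W z) - lam * (∫ z, j (x - z) * W z) =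
        ∫ z, j (x - z) * U z := by
  obtain ⟨V, hV⟩ := IsFourierPair.exists_right hU
  have hne : ∀ ξ, 𝓕 κ ξ - lam ≠ 0 := fun ξ h => by
    have := hlam ξ
    rw [h, norm_zero] at this
    exact absurd hδ this.not_gt
  have hm : MemLp (fun ξ => (𝓕 κ ξ - lam)⁻¹ * V ξ) 2 := by
    refine hV.memLp_right.of_le_mul (c := δ⁻¹) (AEStronglyMeasurable.mul
      (Continuous.aestronglyMeasurable ?_) hV.memLp_right.1) (Filter.Eventually.of_forall
        fun ξ => ?_)
    · exact ((continuous_fourier h1).sub continuous_const).inv₀ hne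
    · rw [norm_mul, norm_inv]
      gcongr
      exact hlam ξ
  obtain ⟨W, hW⟩ := IsFourierPair.exists_left hm
  refine ⟨W, hW.memLp, fun j hj1 hj2 => ?_⟩
  have hjW := hW.convolution hj1 hj2
  refine IsFourierPair.ae_eq (((hjW.convolution h1 h2).sub (hjW.const_mul lam)).congr_right ?_)
    (hV.convolution hj1 hj2)
  refine Filter.Eventually.of_forall fun ξ => ?_
  have := hne ξ
  field_simp

lemma ae_eq_zero_of_convolution_eq {κ : ℝ → ℂ} (h1 : Integrable κ) (h2 : MemLp κ 2) {lam : ℂ}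
    (hlam : ∀ ξ, 𝓕 κ ξ ≠ lam) {D : ℝ → ℂ} (hD : MemLp D 2)
    (h : ∀ᵐ x, (∫ y, κ (x - y) * D y) - lam * D x = 0) : D =ᵐ[volume] 0 := by
  obtain ⟨E, hE⟩ := IsFourierPair.exists_right hD
  have h3 := ((hE.convolution h1 h2).sub (hE.const_mul lam)).congr_left h
  have h0 : IsFourierPair (fun _ => (0 : ℂ)) (fun _ => 0) := by
    simpa using hE.const_mul 0
  have h4 : (fun ξ => 𝓕 κ ξ * E ξ - lam * E ξ) =ᵐ[volume] fun _ => 0 :=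
    h3.2.symm.trans h0.2
  refine (hE.congr_right ?_).ae_eq h0
  filter_upwards [h4] with ξ hξ
  rw [← sub_mul] at hξ
  exact (mul_eq_zero.1 hξ).resolve_left (sub_ne_zero.2 (hlam ξ))

lemma half_cos_mul_le_norm_add_exp {θ : ℝ} (hθ : |θ| ≤ Real.pi) (X : ℝ) :
    Real.cos (θ / 2) * (X + 1) ≤ ‖(X : ℂ) + Complex.exp (Complex.I * θ)‖ := by
  have hc : 0 ≤ Real.cos (θ / 2) := by
    rw [abs_le] at hθ
    exact Real.cos_nonneg_of_neg_pi_div_two_le_of_le (by linarith) (by linarith)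
  have e1 : (X : ℂ) + Complex.exp (Complex.I * θ) = ⟨X + Real.cos θ, Real.sin θ⟩ := by
    rw [mul_comm, Complex.exp_mul_I]
    apply Complex.ext <;> simp [← Complex.ofReal_cos, ← Complex.ofReal_sin]
  refine le_of_sq_le_sq ?_ (norm_nonneg _)
  rw [← Complex.normSq_eq_norm_sq, e1, Complex.normSq_mk, mul_pow, Real.cos_sq (θ / 2)]
  have := Real.sin_sq_add_cos_sq θ
  rw [show 2 * (θ / 2) = θ by ring]
  nlinarith [mul_nonneg (sub_nonneg.2 (Real.cos_le_one θ)) (sq_nonneg (X - 1))]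

lemma integrable_exp_half_div : Integrable fun y : ℝ => Real.exp (y / 2) / (Real.exp y + 1) := by
  have hm : Continuous fun y : ℝ => Real.exp (y / 2) / (Real.exp y + 1) :=
    Continuous.div (by fun_prop) (by fun_prop) fun y => by positivity
  rw [← integrableOn_univ, ← Iic_union_Ioi (a := (0 : ℝ))]
  refine IntegrableOn.union ?_ ?_
  · refine (integrableOn_exp_mul_Iic (a := 1 / 2) (by norm_num) 0).mono'
      hm.aestronglyMeasurable (Filter.Eventually.of_forall fun y => ?_)
    rw [Real.norm_of_nonneg (by positivity), show 1 / 2 * y = y / 2 by ring]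
    exact div_le_self (Real.exp_pos _).le (by linarith [Real.exp_pos y])
  · refine (integrableOn_exp_mul_Ioi (a := -(1 / 2)) (by norm_num) 0).mono'
      hm.aestronglyMeasurable (Filter.Eventually.of_forall fun y => ?_)
    rw [Real.norm_of_nonneg (by positivity), div_le_iff₀ (by positivity), mul_add,
      ← Real.exp_add, show -(1 / 2) * y + y = y / 2 by ring]
    linarith [Real.exp_pos (-(1 / 2) * y)]

/-- The integral `∫ e^{ay} / (e^y + e^{iθ}) dy`. -/
noncomputable def expQuotIntegral (a : ℂ) (θ : ℝ) : ℂ :=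
  ∫ y : ℝ, Complex.exp (a * y) / ((Real.exp y : ℝ) + Complex.exp (Complex.I * θ))

lemma norm_cexp_half {a : ℂ} (ha : a.re = 1 / 2) (y : ℝ) :
    ‖Complex.exp (a * y)‖ = Real.exp (y / 2) := by
  rw [Complex.norm_exp]
  simp [ha]
  ring_nf

lemma exp_add_exp_ne_zero {θ : ℝ} (hθ : |θ| < Real.pi) (y : ℝ) :
    ((Real.exp y : ℝ) : ℂ) + Complex.exp (Complex.I * θ) ≠ 0 := by
  have h := half_cos_mul_le_norm_add_exp hθ.le (Real.exp y)
  have hc : 0 < Real.cos (θ / 2) := by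
    rw [abs_lt] at hθ
    exact Real.cos_pos_of_mem_Ioo ⟨by linarith, by linarith⟩
  intro h0
  rw [h0, norm_zero] at h
  have := mul_pos hc (add_pos (Real.exp_pos y) one_pos)
  linarith

lemma norm_inv_add_exp_le {θ θ₀ : ℝ} (hθ : |θ| ≤ θ₀) (hθ₀ : θ₀ < Real.pi) (y : ℝ) :
    ‖((Real.exp y : ℝ) : ℂ) + Complex.exp (Complex.I * θ)‖⁻¹ ≤
      (Real.cos (θ₀ / 2))⁻¹ * (Real.exp y + 1)⁻¹ := by
  have h0 : 0 ≤ θ₀ := (abs_nonneg θ).trans hθ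
  have hc : 0 < Real.cos (θ₀ / 2) :=
    Real.cos_pos_of_mem_Ioo ⟨by linarith [Real.pi_pos], by linarith⟩
  rw [← mul_inv]
  have hp := Real.exp_pos y
  refine inv_anti₀ (by positivity) (le_trans ?_
    (half_cos_mul_le_norm_add_exp (hθ.trans hθ₀.le) _))
  gcongr
  rw [← Real.cos_abs (θ / 2)]
  refine Real.cos_le_cos_of_nonneg_of_le_pi (abs_nonneg _) (by linarith) ?_
  rw [abs_div, abs_two]
  gcongr

lemma integrable_expQuot {a : ℂ} (ha : a.re = 1 / 2) {θ : ℝ} (hθ : |θ| < Real.pi) :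
    Integrable fun y : ℝ =>
      Complex.exp (a * y) / ((Real.exp y : ℝ) + Complex.exp (Complex.I * θ)) := by
  refine (integrable_exp_half_div.const_mul (Real.cos (|θ| / 2))⁻¹).mono'
    (Continuous.aestronglyMeasurable ?_) (Filter.Eventually.of_forall fun y => ?_)
  · exact Continuous.div (by fun_prop) (by fun_prop) (exp_add_exp_ne_zero hθ)
  · rw [norm_div, norm_cexp_half ha, div_eq_mul_inv, div_eq_mul_inv (Real.exp _), mul_left_comm]
    gcongr
    exact norm_inv_add_exp_le le_rfl hθ y

lemma hasDerivAt_expQuotIntegral {a : ℂ} (ha : a.re = 1 / 2) {θ : ℝ} (hθ : |θ| < Real.pi) :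
    HasDerivAt (expQuotIntegral a) (Complex.I * (a - 1) * expQuotIntegral a θ) θ := by
  obtain ⟨θ₀, h1, h2⟩ := exists_between hθ
  let F' : ℝ → ℝ → ℂ := fun t y => -(Complex.I * Complex.exp (Complex.I * t)) *
    Complex.exp (a * y) / ((Real.exp y : ℝ) + Complex.exp (Complex.I * t)) ^ 2
  have hc : 0 < Real.cos (θ₀ / 2) :=
    Real.cos_pos_of_mem_Ioo ⟨by linarith [Real.pi_pos, abs_nonneg θ], by linarith⟩
  have key := hasDerivAt_integral_of_dominated_loc_of_deriv_le (μ := volume)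
    (F := fun (t : ℝ) (y : ℝ) =>
      Complex.exp (a * y) / ((Real.exp y : ℝ) + Complex.exp (Complex.I * t)))
    (F' := F') (x₀ := θ) (s := Ioo (-θ₀) θ₀)
    (bound := fun y => (Real.cos (θ₀ / 2))⁻¹ ^ 2 * (Real.exp (y / 2) / (Real.exp y + 1)))
    (Ioo_mem_nhds (by linarith [neg_abs_le θ]) (by linarith [le_abs_self θ]))
    (by
      filter_upwards [Ioo_mem_nhds (a := -θ₀) (b := θ₀) (by linarith [neg_abs_le θ])
        (by linarith [le_abs_self θ])] with t ht
      exact (integrable_expQuot ha ((abs_lt.2 ht).trans h2)).1)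
    (integrable_expQuot ha hθ)
    (Continuous.aestronglyMeasurable (Continuous.div (by fun_prop) (by fun_prop)
      fun y => pow_ne_zero 2 (exp_add_exp_ne_zero hθ y)))
    (by
      refine Filter.Eventually.of_forall fun y t ht => ?_
      have hb := norm_inv_add_exp_le (abs_lt.2 ht).le h2 y
      have hexp : ‖Complex.exp (Complex.I * t)‖ = 1 := by
        rw [mul_comm, Complex.norm_exp_ofReal_mul_I]
      simp only [F', norm_div, norm_mul, norm_neg, Complex.norm_I, hexp, norm_cexp_half ha,
        norm_pow, one_mul]
      rw [div_eq_mul_inv, ← inv_pow]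
      have h1e : (Real.exp y + 1)⁻¹ ≤ 1 := inv_le_one_of_one_le₀ (by linarith [Real.exp_pos y])
      calc Real.exp (y / 2) * ‖((Real.exp y : ℝ) : ℂ) + Complex.exp (Complex.I * t)‖⁻¹ ^ 2
          ≤ Real.exp (y / 2) * ((Real.cos (θ₀ / 2))⁻¹ * (Real.exp y + 1)⁻¹) ^ 2 := by gcongr
        _ = Real.exp (y / 2) * (Real.cos (θ₀ / 2))⁻¹ ^ 2 * (Real.exp y + 1)⁻¹ *
            (Real.exp y + 1)⁻¹ := by ring
        _ ≤ Real.exp (y / 2) * (Real.cos (θ₀ / 2))⁻¹ ^ 2 * (Real.exp y + 1)⁻¹ * 1 := by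
          have := Real.exp_pos y
          gcongr
        _ = _ := by rw [div_eq_mul_inv]; ring)
    (integrable_exp_half_div.const_mul _)
    (by
      refine Filter.Eventually.of_forall fun y t ht => ?_
      have hne := exp_add_exp_ne_zero ((abs_lt.2 ht).trans h2) y
      have h3 : HasDerivAt (fun t : ℝ => Complex.exp (Complex.I * t))
          (Complex.exp (Complex.I * t) * (Complex.I * 1)) t :=
        ((Complex.ofRealCLM.hasDerivAt (x := t)).const_mul Complex.I).cexp
      have h4 := (hasDerivAt_const t (Complex.exp (a * y))).div
        (h3.const_add ((Real.exp y : ℝ) : ℂ)) hne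
      convert! h4 using 1
      simp only [F']
      ring)
  obtain ⟨hi, hd⟩ := key
  have hJ := integrable_expQuot ha hθ
  have hzero := integral_eq_zero_of_hasDerivAt_of_integrable
    (f := fun y : ℝ => Complex.exp (a * y) / ((Real.exp y : ℝ) + Complex.exp (Complex.I * θ)))
    (f' := fun y => (a - 1) * (Complex.exp (a * y) /
      ((Real.exp y : ℝ) + Complex.exp (Complex.I * θ))) + Complex.I * F' θ y)
    (fun y => by
      have hne := exp_add_exp_ne_zero hθ y
      have h3 : HasDerivAt (fun y : ℝ => Complex.exp (a * y)) (Complex.exp (a * y) * (a * 1)) y :=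
        ((Complex.ofRealCLM.hasDerivAt (x := y)).const_mul a).cexp
      have h4 := h3.div (((Real.hasDerivAt_exp y).ofReal_comp).add_const
        (Complex.exp (Complex.I * θ))) hne
      convert! h4 using 1
      simp only [F']
      field_simp
      linear_combination (-Complex.exp (Complex.I * θ)) * Complex.I_sq)
    ((hJ.const_mul _).add (hi.const_mul _)) hJ
  rw [integral_add (hJ.const_mul _) (hi.const_mul _), integral_const_mul, integral_const_mul]
    at hzero
  have : ∫ y, F' θ y = Complex.I * (a - 1) * expQuotIntegral a θ := by
    rw [expQuotIntegral]
    linear_combination (-Complex.I) * hzero + (∫ y, F' θ y) * Complex.I_sq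
  rw [← this]
  exact hd

lemma expQuotIntegral_eq {a : ℂ} (ha : a.re = 1 / 2) {θ : ℝ} (hθ : |θ| < Real.pi) :
    expQuotIntegral a θ = Complex.exp (Complex.I * (a - 1) * θ) * expQuotIntegral a 0 := by
  let f : ℝ → ℂ := fun t => Complex.exp (-(Complex.I * (a - 1)) * t) * expQuotIntegral a t
  have hd : ∀ t ∈ Ioo (-Real.pi) Real.pi, HasDerivAt f 0 t := fun t ht => by
    have h3 : HasDerivAt (fun t : ℝ => Complex.exp (-(Complex.I * (a - 1)) * t))
        (Complex.exp (-(Complex.I * (a - 1)) * t) * (-(Complex.I * (a - 1)) * 1)) t :=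
      ((Complex.ofRealCLM.hasDerivAt (x := t)).const_mul _).cexp
    convert! h3.mul (hasDerivAt_expQuotIntegral ha (abs_lt.2 ht)) using 1
    ring
  have h := isOpen_Ioo.is_const_of_deriv_eq_zero isPreconnected_Ioo
    (fun t ht => (hd t ht).differentiableAt.differentiableWithinAt)
    (fun t ht => (hd t ht).deriv) (abs_lt.1 hθ) (y := 0) ⟨by linarith [Real.pi_pos], Real.pi_pos⟩
  simp only [f, Complex.ofReal_zero, mul_zero, Complex.exp_zero, one_mul] at h
  rw [← h, ← mul_assoc, ← Complex.exp_add]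
  simp

lemma expQuotIntegral_zero {a : ℂ} (ha : a.re = 1 / 2) :
    expQuotIntegral a 0 = Real.pi / Complex.sin (Real.pi * a) := by
  have ha' : (1 - a).re = 1 / 2 := by simp [ha]; norm_num
  rw [← Complex.Gamma_mul_Gamma_one_sub,
    Complex.Gamma_mul_Gamma_eq_betaIntegral (by rw [ha]; norm_num) (by rw [ha']; norm_num),
    add_sub_cancel, Complex.Gamma_one, one_mul, Complex.betaIntegral,
    intervalIntegral.integral_of_le zero_le_one, integral_Ioc_eq_integral_Ioo,
    ← Real.range_sigmoid, ← image_univ,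
    integral_image_eq_integral_abs_deriv_smul MeasurableSet.univ
      (fun x _ => (Real.hasDerivAt_sigmoid x).hasDerivWithinAt) Real.sigmoid_injective.injOn,
    setIntegral_univ, expQuotIntegral]
  congr 1
  ext y
  have h1 := Real.sigmoid_pos y
  have h2 : 0 < 1 - Real.sigmoid y := by linarith [Real.sigmoid_lt_one y]
  have e1 : 1 - Real.sigmoid y = (Real.exp y + 1)⁻¹ := by
    rw [Real.sigmoid_def, Real.exp_neg]
    have := Real.exp_pos y
    field_simp
    ring_nf
  have e2 : Real.sigmoid y = Real.exp y * (Real.exp y + 1)⁻¹ := by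
    have := Real.exp_pos y
    linear_combination (-1) * e1 - (mul_inv_cancel₀ (show Real.exp y + 1 ≠ 0 by positivity))
  have hp : 0 < Real.exp y + 1 := by linarith [Real.exp_pos y]
  have hx0 : (1 : ℂ) - (Real.sigmoid y : ℂ) = ((1 - Real.sigmoid y : ℝ) : ℂ) := by push_cast; rfl
  rw [abs_of_pos (mul_pos h1 h2), hx0, e1, e2]
  rw [Complex.ofReal_mul, Complex.mul_cpow_ofReal_nonneg (Real.exp_pos y).le (inv_pos.2 hp).le,
    mul_assoc (((Real.exp y : ℝ) : ℂ) ^ (a - 1)),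
    ← Complex.cpow_add _ _ (by exact_mod_cast (inv_pos.2 hp).ne')]
  rw [show a - 1 + (1 - a - 1) = -1 by ring, Complex.cpow_neg_one, Complex.ofReal_inv, inv_inv,
    Complex.ofReal_exp, ← Complex.ofReal_exp, Complex.cpow_def_of_ne_zero
      (by exact_mod_cast (Real.exp_pos y).ne'), ← Complex.ofReal_log (Real.exp_pos y).le,
      Real.log_exp]
  have e3 : Complex.exp (a * y) = Complex.exp (y * (a - 1)) * ((Real.exp y : ℝ) : ℂ) := by
    rw [Complex.ofReal_exp, ← Complex.exp_add]
    congr 1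
    ring
  rw [e3, Complex.real_smul]
  have hp' : ((Real.exp y : ℝ) : ℂ) + 1 ≠ 0 := by exact_mod_cast hp.ne'
  push_cast at hp' ⊢
  simp only [mul_zero, Complex.exp_zero]
  field_simp

/-- The kernel of `K_α`, conjugated to a convolution kernel on the line by `s = e^x`. -/
noncomputable def cornerKernel (α : ℝ) (r : ℝ) : ℂ :=
  ((Real.exp (r / 2) * (Real.sin α /
    (Real.pi * (Real.exp r ^ 2 - 2 * Real.exp r * Real.cos α + 1))) : ℝ) : ℂ)

lemma corner_quadratic_ge {α : ℝ} (hα0 : 0 < α) (hαπ : α < Real.pi) :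
    ∃ c > 0, ∀ X : ℝ, c * (X + 1) ^ 2 ≤ X ^ 2 - 2 * X * Real.cos α + 1 := by
  have h1 : Real.cos α < 1 := by
    rw [← Real.cos_zero]
    exact Real.cos_lt_cos_of_nonneg_of_le_pi le_rfl hαπ.le hα0
  refine ⟨(1 - Real.cos α) / 2, by linarith, fun X => ?_⟩
  nlinarith [mul_nonneg (by linarith [Real.neg_one_le_cos α] : 0 ≤ 1 + Real.cos α)
    (sq_nonneg (X - 1))]

lemma cornerKernel_eq {α : ℝ} (hα0 : 0 < α) (hαπ : α < Real.pi) (r : ℝ) :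
    cornerKernel α r = (2 * Real.pi * Complex.I)⁻¹ * (Complex.exp ((1 / 2 : ℂ) * r) /
        ((Real.exp r : ℝ) + Complex.exp (Complex.I * ((-(Real.pi - α) : ℝ) : ℂ))) -
      Complex.exp ((1 / 2 : ℂ) * r) /
        ((Real.exp r : ℝ) + Complex.exp (Complex.I * ((Real.pi - α : ℝ) : ℂ)))) := by
  have h1 := exp_add_exp_ne_zero (θ := -(Real.pi - α))
    (by rw [abs_neg, abs_lt]; constructor <;> linarith) r
  have h2 := exp_add_exp_ne_zero (θ := (Real.pi - α)) (by rw [abs_lt]; constructor <;> linarith) r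
  have e1 : Complex.exp (Complex.I * ((-(Real.pi - α) : ℝ) : ℂ)) =
      -(Real.cos α : ℝ) - (Real.sin α : ℝ) * Complex.I := by
    rw [mul_comm, Complex.exp_mul_I, ← Complex.ofReal_cos, ← Complex.ofReal_sin, Real.cos_neg,
      Real.sin_neg, Real.cos_pi_sub, Real.sin_pi_sub]
    push_cast; ring
  have e2 : Complex.exp (Complex.I * ((Real.pi - α : ℝ) : ℂ)) =
      -(Real.cos α : ℝ) + (Real.sin α : ℝ) * Complex.I := by
    rw [mul_comm, Complex.exp_mul_I, ← Complex.ofReal_cos, ← Complex.ofReal_sin,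
      Real.cos_pi_sub, Real.sin_pi_sub]
    push_cast; ring
  have e3 : Complex.exp ((1 / 2 : ℂ) * r) = ((Real.exp (r / 2) : ℝ) : ℂ) := by
    rw [Complex.ofReal_exp]; congr 1; push_cast; ring
  have hsc : ((Real.sin α : ℝ) : ℂ) ^ 2 + ((Real.cos α : ℝ) : ℂ) ^ 2 = 1 := by
    exact_mod_cast Real.sin_sq_add_cos_sq α
  rw [e1] at h1 ⊢
  rw [e2] at h2 ⊢
  have e4 : ((Real.exp r : ℝ) + (-(Real.cos α : ℝ) - (Real.sin α : ℝ) * Complex.I)) *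
      ((Real.exp r : ℝ) + (-(Real.cos α : ℝ) + (Real.sin α : ℝ) * Complex.I)) =
      (((Real.exp r ^ 2 - 2 * Real.exp r * Real.cos α + 1) : ℝ) : ℂ) := by
    simp only [Complex.ofReal_add, Complex.ofReal_sub, Complex.ofReal_mul, Complex.ofReal_pow,
      Complex.ofReal_one, Complex.ofReal_ofNat]
    linear_combination (-((Real.sin α : ℝ) : ℂ) ^ 2) * Complex.I_sq + hsc
  have h3 := mul_ne_zero h1 h2
  rw [e3, div_sub_div _ _ h1 h2, e4, cornerKernel]
  rw [e4] at h3
  have hpi : (Real.pi : ℂ) ≠ 0 := by exact_mod_cast Real.pi_ne_zero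
  push_cast at h3 ⊢
  field_simp
  ring

lemma integrable_cornerKernel {α : ℝ} (hα0 : 0 < α) (hαπ : α < Real.pi) :
    Integrable (cornerKernel α) := by
  rw [funext (cornerKernel_eq hα0 hαπ)]
  refine Integrable.const_mul (Integrable.sub (integrable_expQuot (by simp) ?_)
    (integrable_expQuot (by simp) ?_)) _
  · rw [abs_neg, abs_lt]; constructor <;> linarith
  · rw [abs_lt]; constructor <;> linarith

lemma fourier_cornerKernel {α : ℝ} (hα0 : 0 < α) (hαπ : α < Real.pi) (ξ : ℝ) :
    𝓕 (cornerKernel α) ξ =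
      Complex.sin (((Real.pi - α : ℝ) : ℂ) *
          (((-(1 / 2) : ℝ) : ℂ) + ((-2 * Real.pi * ξ : ℝ) : ℂ) * Complex.I)) /
        Complex.sin ((Real.pi : ℂ) *
          (((-(1 / 2) : ℝ) : ℂ) + ((-2 * Real.pi * ξ : ℝ) : ℂ) * Complex.I)) := by
  set z : ℂ := ((-(1 / 2) : ℝ) : ℂ) + ((-2 * Real.pi * ξ : ℝ) : ℂ) * Complex.I with hz
  have ha : (z + 1).re = 1 / 2 := by simp [hz]; norm_num
  have hθ : |Real.pi - α| < Real.pi := by rw [abs_lt]; constructor <;> linarith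
  have hθ' : |(-(Real.pi - α))| < Real.pi := by rwa [abs_neg]
  have hdiff : 𝓕 (cornerKernel α) ξ = (2 * Real.pi * Complex.I)⁻¹ *
      (expQuotIntegral (z + 1) (-(Real.pi - α)) - expQuotIntegral (z + 1) (Real.pi - α)) := by
    rw [expQuotIntegral, expQuotIntegral, ← integral_sub (integrable_expQuot ha hθ')
      (integrable_expQuot ha hθ), ← integral_const_mul, Real.fourier_real_eq_integral_exp_smul]
    congr 1
    ext r
    have he : Complex.exp ((z + 1) * r) =
        Complex.exp (((-2 * Real.pi * r * ξ : ℝ) : ℂ) * Complex.I) *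
          Complex.exp ((1 / 2 : ℂ) * r) := by
      rw [← Complex.exp_add, hz]
      congr 1
      push_cast
      ring
    rw [cornerKernel_eq hα0 hαπ, he, smul_eq_mul]
    ring
  have hsin : Complex.sin (Real.pi * (z + 1)) = -Complex.sin (Real.pi * z) := by
    rw [mul_add, mul_one, Complex.sin_add_pi]
  rw [hdiff, expQuotIntegral_eq ha hθ, expQuotIntegral_eq ha hθ', expQuotIntegral_zero ha, hsin,
    add_sub_cancel_right, Complex.sin.eq_1 (((Real.pi - α : ℝ) : ℂ) * z)]
  rw [show Complex.I * z * ((-(Real.pi - α) : ℝ) : ℂ) =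
      -(((Real.pi - α : ℝ) : ℂ) * z) * Complex.I by push_cast; ring,
    show Complex.I * z * ((Real.pi - α : ℝ) : ℂ) =
      (((Real.pi - α : ℝ) : ℂ) * z) * Complex.I by ring]
  have hpi : (Real.pi : ℂ) ≠ 0 := by exact_mod_cast Real.pi_ne_zero
  rw [mul_inv, mul_inv, Complex.inv_I]
  field_simp
  ring

lemma memLp_cornerKernel {α : ℝ} (hα0 : 0 < α) (hαπ : α < Real.pi) :
    MemLp (cornerKernel α) 2 := by
  have hi := integrable_cornerKernel hα0 hαπ
  obtain ⟨c, hc, hq⟩ := corner_quadratic_ge hα0 hαπ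
  have hb : ∀ r, ‖cornerKernel α r‖ ≤ 1 / (Real.pi * c) := fun r => by
    have hX := Real.exp_pos (r / 2)
    have hX' : Real.exp r = Real.exp (r / 2) ^ 2 := by
      rw [← Real.exp_nat_mul]; congr 1; push_cast; ring
    have h1 := hq (Real.exp r)
    have h2 : 0 < c * (Real.exp r + 1) ^ 2 := by positivity
    have hs := Real.sin_pos_of_pos_of_lt_pi hα0 hαπ
    rw [cornerKernel, Complex.norm_real, Real.norm_of_nonneg (by
      have := h2.trans_le h1
      positivity), ← mul_div_assoc]
    rw [div_le_div_iff₀ (by have := h2.trans_le h1; positivity) (by positivity), one_mul]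
    have h3 : Real.exp (r / 2) * Real.sin α ≤ (Real.exp r + 1) ^ 2 := by
      nlinarith [Real.sin_le_one α, sq_nonneg (Real.exp (r / 2) - 1), sq_nonneg (Real.exp r)]
    calc _ ≤ (Real.exp r + 1) ^ 2 * (Real.pi * c) := by gcongr
      _ = Real.pi * (c * (Real.exp r + 1) ^ 2) := by ring
      _ ≤ _ := by gcongr
  rw [memLp_two_iff_integrable_sq_norm hi.1]
  refine (hi.norm.const_mul (1 / (Real.pi * c))).mono' (hi.1.norm.pow 2)
    (Filter.Eventually.of_forall fun r => ?_)
  rw [Real.norm_of_nonneg (by positivity), sq]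
  gcongr
  exact hb r

lemma quasiMeasurePreserving_exp :
    Measure.QuasiMeasurePreserving Real.exp volume (volume.restrict (Ioi (0 : ℝ))) := by
  refine ⟨Real.measurable_exp, Measure.AbsolutelyContinuous.mk fun s hs h0 => ?_⟩
  rw [Measure.map_apply Real.measurable_exp hs]
  rw [Measure.restrict_apply hs] at h0
  have : Real.exp ⁻¹' s = Real.log '' (s ∩ Ioi 0) := by
    ext x
    refine ⟨fun hx => ⟨Real.exp x, ⟨hx, Real.exp_pos x⟩, Real.log_exp x⟩, ?_⟩
    rintro ⟨y, ⟨hy, hy0⟩, rfl⟩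
    rwa [mem_preimage, Real.exp_log hy0]
  rw [this]
  exact addHaar_image_eq_zero_of_differentiableOn_of_addHaar_eq_zero volume
    (fun x hx => (Real.differentiableAt_log hx.2.ne').differentiableWithinAt) h0

lemma quasiMeasurePreserving_log :
    Measure.QuasiMeasurePreserving Real.log (volume.restrict (Ioi (0 : ℝ))) volume := by
  refine ⟨Real.measurable_log, Measure.AbsolutelyContinuous.mk fun s hs h0 => ?_⟩
  rw [Measure.map_apply Real.measurable_log hs, Measure.restrict_apply (Real.measurable_log hs)]
  have : Real.log ⁻¹' s ∩ Ioi 0 = Real.exp '' s := by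
    ext x
    refine ⟨fun hx => ⟨Real.log x, hx.1, Real.exp_log hx.2⟩, ?_⟩
    rintro ⟨y, hy, rfl⟩
    exact ⟨by rwa [mem_preimage, Real.log_exp], Real.exp_pos y⟩
  rw [this]
  exact addHaar_image_eq_zero_of_differentiableOn_of_addHaar_eq_zero volume
    Real.differentiable_exp.differentiableOn h0

lemma ae_Ioi_iff_ae_exp {p : ℝ → Prop} :
    (∀ᵐ s ∂(volume.restrict (Ioi (0 : ℝ))), p s) ↔ ∀ᵐ x : ℝ, p (Real.exp x) := by
  refine ⟨fun h => quasiMeasurePreserving_exp.ae h, fun h => ?_⟩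
  filter_upwards [quasiMeasurePreserving_log.ae h, ae_restrict_mem measurableSet_Ioi] with s hs h0
  rwa [Real.exp_log h0] at hs

lemma integrableOn_Ioi_iff_integrable_exp {E : Type*} [NormedAddCommGroup E] [NormedSpace ℝ E]
    (f : ℝ → E) :
    IntegrableOn f (Ioi 0) ↔ Integrable (fun y : ℝ => Real.exp y • f (Real.exp y)) := by
  rw [← Real.range_exp, ← image_univ, integrableOn_image_iff_integrableOn_abs_deriv_smul
    MeasurableSet.univ (fun x _ => (Real.hasDerivAt_exp x).hasDerivWithinAt)
    Real.exp_injective.injOn, integrableOn_univ]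
  simp only [abs_of_pos (Real.exp_pos _)]

lemma integral_Ioi_eq_integral_exp {E : Type*} [NormedAddCommGroup E] [NormedSpace ℝ E]
    (f : ℝ → E) : ∫ t in Ioi (0 : ℝ), f t = ∫ y : ℝ, Real.exp y • f (Real.exp y) := by
  rw [← Real.range_exp, ← image_univ, integral_image_eq_integral_abs_deriv_smul
    MeasurableSet.univ (fun x _ => (Real.hasDerivAt_exp x).hasDerivWithinAt)
    Real.exp_injective.injOn, setIntegral_univ]
  simp only [abs_of_pos (Real.exp_pos _)]

lemma memLp_two_exp_half_mul_iff {u : ℝ → ℂ} :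
    MemLp (fun y : ℝ => ((Real.exp (y / 2) : ℝ) : ℂ) * u (Real.exp y)) 2 ↔
      MemLp u 2 (volume.restrict (Ioi 0)) := by
  have hc : ∀ y : ℝ, ((Real.exp (y / 2) : ℝ) : ℂ) ≠ 0 := fun y => by
    exact_mod_cast (Real.exp_pos _).ne'
  have hm : AEStronglyMeasurable (fun y : ℝ => ((Real.exp (y / 2) : ℝ) : ℂ) * u (Real.exp y)) ↔
      AEStronglyMeasurable u (volume.restrict (Ioi 0)) := by
    have hcont : Continuous fun y : ℝ => ((Real.exp (y / 2) : ℝ) : ℂ) := by fun_prop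
    refine ⟨fun h => ?_, fun h => hcont.aestronglyMeasurable.mul
      (h.comp_quasiMeasurePreserving quasiMeasurePreserving_exp)⟩
    have h2 : AEStronglyMeasurable (fun y : ℝ => u (Real.exp y)) := by
      convert! (hcont.inv₀ hc).aestronglyMeasurable.mul h using 1
      ext y
      exact (inv_mul_cancel_left₀ (hc y) _).symm
    refine (h2.comp_quasiMeasurePreserving quasiMeasurePreserving_log).congr ?_
    filter_upwards [ae_restrict_mem measurableSet_Ioi] with s hs
    simp [Real.exp_log hs]
  by_cases h : AEStronglyMeasurable u (volume.restrict (Ioi 0))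
  · rw [memLp_two_iff_integrable_sq_norm h, memLp_two_iff_integrable_sq_norm (hm.2 h)]
    refine Iff.trans (iff_of_eq ?_) (integrableOn_Ioi_iff_integrable_exp _).symm
    congr 1
    ext y
    rw [norm_mul, mul_pow, Complex.norm_real, Real.norm_of_nonneg (Real.exp_pos _).le,
      ← Real.exp_nat_mul, smul_eq_mul]
    congr 2
    push_cast
    ring
  · exact ⟨fun h' => absurd (hm.1 h'.1) h, fun h' => absurd h'.1 h⟩

/-- The unitary change of variables `s = e^x` from `L²((0,∞), s⁻² ds)` to `L²(ℝ)`. -/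
noncomputable def toLine (p : ℝ → ℂ) (x : ℝ) : ℂ :=
  ((Real.exp (-(x / 2)) : ℝ) : ℂ) * p (Real.exp x)

lemma memLp_toLine_iff {p : ℝ → ℂ} :
    MemLp (toLine p) 2 ↔ MemLp (fun s => p s / s) 2 (volume.restrict (Ioi 0)) := by
  rw [← memLp_two_exp_half_mul_iff]
  refine iff_of_eq (congrArg (fun f => MemLp f 2 volume) (funext fun y => ?_))
  have h : ((Real.exp y : ℝ) : ℂ) =
      ((Real.exp (y / 2) : ℝ) : ℂ) * ((Real.exp (y / 2) : ℝ) : ℂ) := by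
    rw [← Complex.ofReal_mul, ← Real.exp_add, add_halves]
  have h0 : ((Real.exp (y / 2) : ℝ) : ℂ) ≠ 0 := by exact_mod_cast (Real.exp_pos _).ne'
  rw [toLine, Real.exp_neg, h, Complex.ofReal_inv]
  field_simp

/-- The Mellin convolution kernel `k_α`. -/
noncomputable def mellinKernel (α s t : ℝ) : ℝ :=
  s * Real.sin α / (Real.pi * (s ^ 2 - 2 * s * t * Real.cos α + t ^ 2))

/-- The operator `K_α`. -/
noncomputable def cornerOp (α : ℝ) (p : ℝ → ℂ) (s : ℝ) : ℂ :=
  ∫ t in Ioi (0 : ℝ), (mellinKernel α s t : ℂ) * p t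

lemma exp_smul_mellinKernel_mul {α : ℝ} (hα0 : 0 < α) (hαπ : α < Real.pi) (p : ℝ → ℂ) (x y : ℝ) :
    ((Real.exp (-(x / 2)) : ℝ) : ℂ) *
        (Real.exp y • ((mellinKernel α (Real.exp x) (Real.exp y) : ℂ) * p (Real.exp y))) =
      cornerKernel α (x - y) * toLine p y := by
  obtain ⟨c, hc, hq⟩ := corner_quadratic_ge hα0 hαπ
  rw [toLine, cornerKernel, mellinKernel, Complex.real_smul, ← mul_assoc, ← mul_assoc, ← mul_assoc]
  congr 1
  norm_cast
  have hQ := (by positivity : 0 < c * (Real.exp (x - y) + 1) ^ 2).trans_le (hq (Real.exp (x - y)))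
  set X := Real.exp (x / 2) with hX
  set Y := Real.exp (y / 2) with hY
  have hX0 : 0 < X := Real.exp_pos _
  have hY0 : 0 < Y := Real.exp_pos _
  have e1 : Real.exp x = X ^ 2 := by rw [hX, ← Real.exp_nat_mul]; congr 1; push_cast; ring
  have e2 : Real.exp y = Y ^ 2 := by rw [hY, ← Real.exp_nat_mul]; congr 1; push_cast; ring
  have e3 : Real.exp ((x - y) / 2) = X / Y := by rw [hX, hY, ← Real.exp_sub]; congr 1; ring
  rw [Real.exp_sub, e1, e2] at hQ
  rw [Real.exp_sub x y, e1, e2, e3, Real.exp_neg, Real.exp_neg, ← hX, ← hY]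
  have hQ2 : (X ^ 2) ^ 2 - 2 * X ^ 2 * Y ^ 2 * Real.cos α + (Y ^ 2) ^ 2 =
      (Y ^ 2) ^ 2 * ((X ^ 2 / Y ^ 2) ^ 2 - 2 * (X ^ 2 / Y ^ 2) * Real.cos α + 1) := by
    field_simp
  rw [hQ2]
  generalize ((X ^ 2 / Y ^ 2) ^ 2 - 2 * (X ^ 2 / Y ^ 2) * Real.cos α + 1) = Q at hQ ⊢
  field_simp

lemma toLine_cornerOp {α : ℝ} (hα0 : 0 < α) (hαπ : α < Real.pi) (p : ℝ → ℂ) (x : ℝ) :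
    toLine (cornerOp α p) x = ∫ y, cornerKernel α (x - y) * toLine p y := by
  rw [toLine, cornerOp, integral_Ioi_eq_integral_exp, ← integral_const_mul]
  congr 1
  ext y
  exact exp_smul_mellinKernel_mul hα0 hαπ p x y

/-- The convolution kernel on the line of `u ↦ (s ↦ ∫_0^s u)`. -/
noncomputable def primitiveKernel : ℝ → ℂ :=
  (Ici 0).indicator fun r => ((Real.exp (-(r / 2)) : ℝ) : ℂ)

lemma integrable_primitiveKernel : Integrable primitiveKernel := by
  rw [primitiveKernel, integrable_indicator_iff measurableSet_Ici,
    integrableOn_Ici_iff_integrableOn_Ioi]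
  refine Integrable.ofReal ((integrableOn_exp_mul_Ioi (a := -(1 / 2)) (by norm_num) 0).congr
    (ae_of_all _ fun r => ?_))
  dsimp only
  congr 1
  ring

lemma memLp_primitiveKernel : MemLp primitiveKernel 2 := by
  have hi := integrable_primitiveKernel
  rw [memLp_two_iff_integrable_sq_norm hi.1]
  refine hi.norm.mono' (hi.1.norm.pow 2) (ae_of_all _ fun r => ?_)
  have : ‖primitiveKernel r‖ ≤ 1 := by
    rw [primitiveKernel, indicator_apply]
    split_ifs with h
    · rw [Complex.norm_real, Real.norm_of_nonneg (Real.exp_pos _).le, Real.exp_le_one_iff]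
      linarith [mem_Ici.1 h]
    · simp
  rw [Real.norm_of_nonneg (by positivity), sq]
  exact mul_le_of_le_one_left (norm_nonneg _) this

lemma toLine_primitive (u : ℝ → ℂ) (x : ℝ) :
    toLine (fun s => ∫ t in (0 : ℝ)..s, u t) x =
      ∫ y, primitiveKernel (x - y) * (((Real.exp (y / 2) : ℝ) : ℂ) * u (Real.exp y)) := by
  rw [toLine, intervalIntegral.integral_of_le (Real.exp_pos x).le,
    show Ioc 0 (Real.exp x) = Ioi 0 ∩ Iic (Real.exp x) from rfl,
    ← setIntegral_indicator measurableSet_Iic, integral_Ioi_eq_integral_exp, ← integral_const_mul]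
  congr 1
  ext y
  rw [primitiveKernel, indicator_apply, indicator_apply]
  simp only [mem_Iic, Real.exp_le_exp, mem_Ici, sub_nonneg]
  split_ifs with h
  · rw [Complex.real_smul, ← mul_assoc, ← mul_assoc]
    congr 1
    norm_cast
    rw [← Real.exp_add, ← Real.exp_add]
    congr 1
    ring
  · simp

lemma integrableOn_mellinKernel_mul {α : ℝ} (hα0 : 0 < α) (hαπ : α < Real.pi) {p : ℝ → ℂ}
    (hp : MemLp (toLine p) 2) {s : ℝ} (hs : 0 < s) :
    IntegrableOn (fun t => (mellinKernel α s t : ℂ) * p t) (Ioi 0) := by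
  obtain ⟨x, rfl⟩ : ∃ x, Real.exp x = s := ⟨_, Real.exp_log hs⟩
  rw [integrableOn_Ioi_iff_integrable_exp]
  have h0 : ((Real.exp (-(x / 2)) : ℝ) : ℂ) ≠ 0 := by exact_mod_cast (Real.exp_pos _).ne'
  have hκ : MemLp (fun y => cornerKernel α (x - y)) 2 :=
    (memLp_cornerKernel hα0 hαπ).comp_measurePreserving (Measure.measurePreserving_sub_left _ x)
  refine ((hκ.integrable_mul hp).const_mul ((Real.exp (-(x / 2)) : ℝ) : ℂ)⁻¹).congr
    (ae_of_all _ fun y => ?_)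
  simp only [Pi.mul_apply]
  rw [← exp_smul_mellinKernel_mul hα0 hαπ, inv_mul_cancel_left₀ h0]

lemma mellinKernel_integral {α : ℝ} (hα0 : 0 < α) (hαπ : α < Real.pi) {s : ℝ} (hs : 0 < s) :
    IntegrableOn (mellinKernel α s) (Ioi 0) ∧
      ∫ t in Ioi (0 : ℝ), mellinKernel α s t = 1 - α / Real.pi := by
  have hsin := Real.sin_pos_of_pos_of_lt_pi hα0 hαπ
  have hpi := Real.pi_pos
  have hq : ∀ t : ℝ, s ^ 2 - 2 * s * t * Real.cos α + t ^ 2 =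
      (s * Real.sin α) ^ 2 + (t - s * Real.cos α) ^ 2 := fun t => by
    linear_combination (-s ^ 2) * Real.sin_sq_add_cos_sq α
  have hd : ∀ t : ℝ, HasDerivAt
      (fun t => Real.arctan ((t - s * Real.cos α) / (s * Real.sin α)) / Real.pi)
      (mellinKernel α s t) t := fun t => by
    convert! ((((hasDerivAt_id t).sub_const (s * Real.cos α)).div_const
      (s * Real.sin α)).arctan.div_const Real.pi) using 1
    rw [mellinKernel, hq]
    simp only [id]
    have : 0 < (s * Real.sin α) ^ 2 + (t - s * Real.cos α) ^ 2 := by positivity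
    field_simp
  have hpos : ∀ t ∈ Ioi (0 : ℝ), 0 ≤ mellinKernel α s t := fun t _ => by
    rw [mellinKernel, hq]
    positivity
  have hlim : Filter.Tendsto
      (fun t => Real.arctan ((t - s * Real.cos α) / (s * Real.sin α)) / Real.pi) Filter.atTop
      (nhds (Real.pi / 2 / Real.pi)) := by
    refine Filter.Tendsto.div_const ((Real.tendsto_arctan_atTop.mono_right
      nhdsWithin_le_nhds).comp ?_) _
    exact (Filter.tendsto_atTop_add_const_right _ (-(s * Real.cos α))
      Filter.tendsto_id).atTop_div_const (by positivity)
  refine ⟨integrableOn_Ioi_deriv_of_nonneg' (fun t _ => hd t) hpos hlim, ?_⟩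
  rw [integral_Ioi_of_hasDerivAt_of_nonneg' (fun t _ => hd t) hpos hlim]
  have h0 : (0 - s * Real.cos α) / (s * Real.sin α) = -Real.tan (Real.pi / 2 - α) := by
    rw [Real.tan_pi_div_two_sub, Real.tan_eq_sin_div_cos]
    field_simp
    ring
  rw [h0, Real.arctan_neg, Real.arctan_tan (by linarith) (by linarith)]
  field_simp
  ring

lemma cornerOp_const_add {α : ℝ} (hα0 : 0 < α) (hαπ : α < Real.pi) (a : ℂ) {p : ℝ → ℂ}
    (hp : MemLp (toLine p) 2) {s : ℝ} (hs : 0 < s) :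
    cornerOp α (fun t => a + p t) s = a * ((1 - α / Real.pi : ℝ) : ℂ) + cornerOp α p s := by
  obtain ⟨hi, hv⟩ := mellinKernel_integral hα0 hαπ hs
  have ha : IntegrableOn (fun t => (mellinKernel α s t : ℂ) * a) (Ioi 0) := hi.ofReal.mul_const a
  simp only [cornerOp, mul_add]
  rw [integral_add ha (integrableOn_mellinKernel_mul hα0 hαπ hp hs),
    integral_mul_const, integral_complex_ofReal, hv, mul_comm]

lemma intervalIntegrable_of_memLp {u : ℝ → ℂ} (hu : MemLp u 2 (volume.restrict (Ioi 0)))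
    {x y : ℝ} (hx : 0 ≤ x) (hxy : x ≤ y) : IntervalIntegrable u volume x y := by
  rw [intervalIntegrable_iff_integrableOn_Ioc_of_le hxy]
  exact (hu.mono_measure (Measure.restrict_mono (fun t ht => hx.trans_lt ht.1) le_rfl)).integrable
    one_le_two

/-- **Hardy's inequality**, qualitative form. -/
lemma memLp_toLine_primitive {u : ℝ → ℂ} (hu : MemLp u 2 (volume.restrict (Ioi 0))) :
    MemLp (toLine fun s => ∫ t in (0 : ℝ)..s, u t) 2 := by
  obtain ⟨F, hF⟩ := IsFourierPair.exists_right (memLp_two_exp_half_mul_iff.2 hu)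
  rw [funext (toLine_primitive u)]
  exact (hF.convolution integrable_primitiveKernel memLp_primitiveKernel).memLp

lemma eq_zero_of_integrableOn_div_sq {c : ℂ} {ε : ℝ} (hε : 0 < ε)
    (h : IntegrableOn (fun s : ℝ => ‖c‖ ^ 2 / s ^ 2) (Ioo 0 ε)) : c = 0 := by
  by_contra hc
  have h2 : IntegrableOn (fun s : ℝ => s ^ (-2 : ℝ)) (Ioo 0 ε) := by
    refine (h.const_mul (‖c‖ ^ 2)⁻¹).congr ((ae_restrict_mem measurableSet_Ioo).mono fun s hs => ?_)
    have : ‖c‖ ≠ 0 := norm_ne_zero_iff.2 hc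
    dsimp only
    rw [Real.rpow_neg hs.1.le, Real.rpow_two]
    field_simp
  rw [intervalIntegral.integrableOn_Ioo_rpow_iff hε] at h2
  norm_num at h2

/-- An absolutely continuous function in the weighted space is a primitive, from `0`, of an
`L²` function. -/
lemma exists_memLp_eq_primitive {g g' : ℝ → ℂ}
    (hac : ∀ a c : ℝ, 0 < a → a ≤ c → g c - g a = ∫ s in a..c, g' s)
    (hw : IntegrableOn (fun s : ℝ => ‖g s‖ ^ 2 / s ^ 2) (Ioi 0))
    (hd : IntegrableOn (fun s : ℝ => ‖g' s‖ ^ 2) (Ioi 0)) :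
    ∃ u : ℝ → ℂ, MemLp u 2 (volume.restrict (Ioi 0)) ∧
      ∀ s, 0 < s → g s = ∫ t in (0 : ℝ)..s, u t := by
  by_cases hloc : ∀ a c : ℝ, 0 < a → a ≤ c → IntervalIntegrable g' volume a c
  · have hm : AEStronglyMeasurable g' (volume.restrict (Ioi 0)) := by
      have : Ioi (0 : ℝ) = ⋃ n : ℕ, Ioc ((n : ℝ) + 1)⁻¹ (n + 1) := by
        ext s
        simp only [mem_Ioi, mem_iUnion, mem_Ioc]
        refine ⟨fun hs => ?_, fun ⟨n, hn, _⟩ => lt_trans (by positivity) hn⟩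
        obtain ⟨n, hn⟩ := exists_nat_gt (max s s⁻¹)
        refine ⟨n, ?_, by linarith [le_max_left s s⁻¹]⟩
        exact inv_lt_of_inv_lt₀ hs (by linarith [le_max_right s s⁻¹])
      rw [this, aestronglyMeasurable_iUnion_iff]
      intro n
      have h1 : ((n : ℝ) + 1)⁻¹ ≤ n + 1 :=
        (inv_le_one_of_one_le₀ (by linarith [n.cast_nonneg (α := ℝ)])).trans
          (by linarith [n.cast_nonneg (α := ℝ)])
      exact ((intervalIntegrable_iff_integrableOn_Ioc_of_le h1).1
        (hloc _ _ (by positivity) h1)).aestronglyMeasurable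
    have hL := (memLp_two_iff_integrable_sq_norm hm).2 hd
    refine ⟨g', hL, ?_⟩
    set r : ℝ → ℂ := fun s => ∫ t in (0 : ℝ)..s, g' t with hr
    have hdiff : ∀ x y, 0 < x → x ≤ y → g y - r y = g x - r x := fun x y hx hxy => by
      have := intervalIntegral.integral_add_adjacent_intervals
        (intervalIntegrable_of_memLp hL le_rfl hx.le) (intervalIntegrable_of_memLp hL hx.le hxy)
      simp only [hr]
      linear_combination hac x y hx hxy + this
    have hconst : ∀ s, 0 < s → g s - r s = g 1 - r 1 := fun s hs => by
      rcases le_total s 1 with h | h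
      · exact (hdiff s 1 hs h).symm
      · exact hdiff 1 s one_pos h
    set L := g 1 - r 1
    have hL0 : L = 0 := by
      by_contra hne
      have hcont : ContinuousOn r (Icc 0 1) := by
        have := intervalIntegral.continuousOn_primitive_interval' (b₁ := 0) (b₂ := 1) (a := 0)
          (intervalIntegrable_of_memLp hL le_rfl zero_le_one) left_mem_uIcc
        rwa [uIcc_of_le zero_le_one] at this
      obtain ⟨δ, hδ, hδ'⟩ := Metric.continuousWithinAt_iff.1
        (hcont 0 (left_mem_Icc.2 zero_le_one)) (‖L‖ / 2) (by positivity)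
      have hsmall : ∀ s ∈ Ioo 0 (min δ 1), ‖L / 2‖ ≤ ‖g s‖ := fun s hs => by
        have h1 := hδ' (x := s) ⟨hs.1.le, hs.2.le.trans (min_le_right _ _)⟩ (by
          rw [Real.dist_eq, sub_zero, abs_of_pos hs.1]
          exact hs.2.trans_le (min_le_left _ _))
        rw [show r 0 = 0 from intervalIntegral.integral_same, dist_zero_right] at h1
        have h2 : L = g s - r s := (hconst s hs.1).symm
        have h3 := norm_sub_le (g s) (r s)
        rw [← h2] at h3
        rw [norm_div, Complex.norm_ofNat]
        linarith
      have := eq_zero_of_integrableOn_div_sq (c := L / 2) (ε := min δ 1) (by positivity)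
        ((hw.mono_set Ioo_subset_Ioi_self).mono'
        (measurable_const.div (measurable_id.pow_const 2)).aestronglyMeasurable
        ((ae_restrict_mem measurableSet_Ioo).mono fun s hs => by
          rw [Real.norm_of_nonneg (by positivity)]
          gcongr
          exact hsmall s hs))
      exact hne (by simpa using this)
    intro s hs
    rw [← sub_eq_zero, ← hL0]
    exact hconst s hs
  · push Not at hloc
    obtain ⟨a, c, ha, hac', hni⟩ := hloc
    have hbig : ∀ x y, 0 < x → x ≤ a → c ≤ y → g y = g x := fun x y hx hxa hcy => by
      rw [← sub_eq_zero, hac x y hx (hxa.trans (hac'.trans hcy)), intervalIntegral.integral_undef]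
      exact fun h => hni (h.mono_set (by
        rw [uIcc_of_le hac', uIcc_of_le (hxa.trans (hac'.trans hcy))]
        exact Icc_subset_Icc hxa hcy))
    have hall : ∀ s, 0 < s → g s = g a := fun s hs => by
      rcases le_total s a with h | h
      · exact (hbig s c hs h le_rfl).symm.trans (hbig a c ha le_rfl le_rfl)
      rcases le_total c s with h' | h'
      · exact hbig a s ha le_rfl h'
      by_cases hi : IntervalIntegrable g' volume a s
      · have hi' : ¬ IntervalIntegrable g' volume s c := fun h2 => hni (hi.trans h2)
        have := hac s c hs h'
        rw [intervalIntegral.integral_undef hi', sub_eq_zero] at this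
        exact this.symm.trans (hbig a c ha le_rfl le_rfl)
      · have := hac a s ha h
        rwa [intervalIntegral.integral_undef hi, sub_eq_zero] at this
    have h0 : g a = 0 := eq_zero_of_integrableOn_div_sq one_pos
      ((hw.mono_set Ioo_subset_Ioi_self).congr_fun (fun s hs => by
        simp only [hall s hs.1]) measurableSet_Ioo)
    exact ⟨0, MemLp.zero, fun s hs => by simp [hall s hs, h0]⟩

lemma toLine_eq_toLine_iff {p q : ℝ → ℂ} {x : ℝ} :
    toLine p x = toLine q x ↔ p (Real.exp x) = q (Real.exp x) :=
  mul_right_inj' (by exact_mod_cast (Real.exp_pos _).ne')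

lemma memLp_cornerOp {α : ℝ} (hα0 : 0 < α) (hαπ : α < Real.pi) {p : ℝ → ℂ}
    (hp : MemLp (toLine p) 2) : MemLp (toLine (cornerOp α p)) 2 := by
  obtain ⟨F, hF⟩ := IsFourierPair.exists_right hp
  rw [funext (toLine_cornerOp hα0 hαπ p)]
  exact (hF.convolution (integrable_cornerKernel hα0 hαπ) (memLp_cornerKernel hα0 hαπ)).memLp

lemma toLine_sub_mul (p q : ℝ → ℂ) (c : ℂ) (x : ℝ) :
    toLine (fun s => p s - c * q s) x = toLine p x - c * toLine q x := by
  simp only [toLine]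
  ring

lemma cornerOp_sub {α : ℝ} (hα0 : 0 < α) (hαπ : α < Real.pi) {p q : ℝ → ℂ}
    (hp : MemLp (toLine p) 2) (hq : MemLp (toLine q) 2) {s : ℝ} (hs : 0 < s) :
    cornerOp α (fun t => p t - q t) s = cornerOp α p s - cornerOp α q s := by
  simp only [cornerOp, mul_sub]
  exact integral_sub (integrableOn_mellinKernel_mul hα0 hαπ hp hs)
    (integrableOn_mellinKernel_mul hα0 hαπ hq hs)

/-- The symbol of `K_α` stays at positive distance from any `λ` off the closed symbol curve. -/
lemma exists_le_norm_fourier_cornerKernel_sub {α : ℝ} (hα0 : 0 < α) (hαπ : α < Real.pi) {lam : ℂ}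
    (hlam : lam ∉ closure (Set.range (fun t : ℝ =>
      Complex.sin (((Real.pi - α : ℝ) : ℂ) * (((-(1 / 2) : ℝ) : ℂ) + (t : ℂ) * Complex.I)) /
        Complex.sin ((Real.pi : ℂ) * (((-(1 / 2) : ℝ) : ℂ) + (t : ℂ) * Complex.I))))) :
    ∃ δ > 0, ∀ ξ, δ ≤ ‖𝓕 (cornerKernel α) ξ - lam‖ := by
  rw [Metric.mem_closure_range_iff] at hlam
  push Not at hlam
  obtain ⟨δ, hδ, h⟩ := hlam
  refine ⟨δ, hδ, fun ξ => ?_⟩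
  rw [fourier_cornerKernel hα0 hαπ, ← dist_eq_norm, dist_comm]
  exact h (-2 * Real.pi * ξ)

/-- Invertibility of `K_α - λ` on `W₀¹`: existence. -/
lemma exists_cornerOp_primitive_eq {α : ℝ} (hα0 : 0 < α) (hαπ : α < Real.pi) {lam : ℂ} {δ : ℝ}
    (hδ : 0 < δ) (hlam : ∀ ξ, δ ≤ ‖𝓕 (cornerKernel α) ξ - lam‖) {u : ℝ → ℂ}
    (hu : MemLp u 2 (volume.restrict (Ioi 0))) :
    ∃ w : ℝ → ℂ, MemLp w 2 (volume.restrict (Ioi 0)) ∧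
      ∀ᵐ s ∂(volume.restrict (Ioi (0 : ℝ))),
        cornerOp α (fun s => ∫ t in (0 : ℝ)..s, w t) s - lam * (∫ t in (0 : ℝ)..s, w t) =
          ∫ t in (0 : ℝ)..s, u t := by
  obtain ⟨W, hW, h⟩ := exists_convolution_eq (integrable_cornerKernel hα0 hαπ)
    (memLp_cornerKernel hα0 hαπ) hδ hlam (memLp_two_exp_half_mul_iff.2 hu)
  let w : ℝ → ℂ := fun s => ((Real.exp (-(Real.log s / 2)) : ℝ) : ℂ) * W (Real.log s)
  have hw : ∀ y : ℝ, ((Real.exp (y / 2) : ℝ) : ℂ) * w (Real.exp y) = W y := fun y => by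
    simp only [w, Real.log_exp]
    rw [← mul_assoc, ← Complex.ofReal_mul, ← Real.exp_add, add_neg_cancel, Real.exp_zero,
      Complex.ofReal_one, one_mul]
  refine ⟨w, memLp_two_exp_half_mul_iff.1 (by rwa [funext hw]), ae_Ioi_iff_ae_exp.2 ?_⟩
  filter_upwards [h _ integrable_primitiveKernel memLp_primitiveKernel] with x hx
  refine (toLine_eq_toLine_iff (p := fun s => cornerOp α (fun s => ∫ t in (0 : ℝ)..s, w t) s -
    lam * (∫ t in (0 : ℝ)..s, w t)) (q := fun s => ∫ t in (0 : ℝ)..s, u t)).1 ?_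
  rw [toLine_sub_mul, toLine_cornerOp hα0 hαπ]
  simp only [toLine_primitive, hw]
  exact hx

/-- Injectivity of `K_α - λ` modulo constants. -/
lemma eq_zero_of_const_add_cornerOp_sub {α : ℝ} (hα0 : 0 < α) (hαπ : α < Real.pi) {lam : ℂ}
    (hlam : ∀ ξ, 𝓕 (cornerKernel α) ξ ≠ lam) {c : ℂ} {p : ℝ → ℂ} (hp : MemLp (toLine p) 2)
    (h : ∀ᵐ s ∂(volume.restrict (Ioi (0 : ℝ))), c + (cornerOp α p s - lam * p s) = 0) :
    c = 0 ∧ p =ᵐ[volume.restrict (Ioi 0)] 0 := by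
  have hN : MemLp (toLine fun s => cornerOp α p s - lam * p s) 2 := by
    rw [funext (toLine_sub_mul _ _ _)]
    exact (memLp_cornerOp hα0 hαπ hp).sub (hp.const_mul lam)
  have hc : c = 0 := by
    have h1 : MemLp (fun s : ℝ => c / (s : ℂ)) 2 (volume.restrict (Ioi 0)) := by
      refine (memLp_congr_ae ?_).1 (memLp_toLine_iff.1 hN).neg
      filter_upwards [h] with s hs
      rw [eq_neg_of_add_eq_zero_left hs, Pi.neg_apply, neg_div]
    refine eq_zero_of_integrableOn_div_sq one_pos ?_
    have h2 := (memLp_two_iff_integrable_sq_norm h1.1).1 h1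
    simp only [norm_div, div_pow, Complex.norm_real, Real.norm_eq_abs, sq_abs] at h2
    exact IntegrableOn.mono_set h2 Ioo_subset_Ioi_self
  refine ⟨hc, ae_Ioi_iff_ae_exp.2 ?_⟩
  have h0 := ae_eq_zero_of_convolution_eq (integrable_cornerKernel hα0 hαπ)
    (memLp_cornerKernel hα0 hαπ) hlam hp (by
      filter_upwards [ae_Ioi_iff_ae_exp.1 h] with x hx
      rw [hc, zero_add] at hx
      rw [← toLine_cornerOp hα0 hαπ, ← toLine_sub_mul, toLine, hx, mul_zero])
  filter_upwards [h0] with x hx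
  exact toLine_eq_toLine_iff.1 (hx.trans (by simp [toLine]))

lemma continuousOn_primitive_Ioi {u : ℝ → ℂ} (hu : MemLp u 2 (volume.restrict (Ioi 0))) :
    ContinuousOn (fun s => ∫ t in (0 : ℝ)..s, u t) (Ioi 0) := by
  intro s hs
  have hs : 0 < s := hs
  have h := intervalIntegral.continuousOn_primitive_interval' (b₁ := 0) (b₂ := s + 1) (a := 0)
    (intervalIntegrable_of_memLp hu le_rfl (by linarith)) left_mem_uIcc
  rw [uIcc_of_le (by linarith)] at h
  exact (h.continuousAt (Icc_mem_nhds hs (by linarith))).continuousWithinAt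

lemma memLp_deriv_cutoff {φ : ℝ → ℝ} (hφ : ContDiff ℝ (⊤ : ℕ∞) φ)
    (hφzero : ∀ s : ℝ, 1 ≤ s → φ s = 0) :
    MemLp (fun s => ((deriv φ s : ℝ) : ℂ)) 2 (volume.restrict (Ioi 0)) := by
  have hc : Continuous fun s => ((deriv φ s : ℝ) : ℂ) :=
    Complex.continuous_ofReal.comp (hφ.continuous_deriv (by simp))
  obtain ⟨C, hC⟩ := (isCompact_Icc (a := (0 : ℝ)) (b := 1)).exists_bound_of_continuousOn
    hc.continuousOn
  have h1 : MemLp (fun s => ((deriv φ s : ℝ) : ℂ)) 2 (volume.restrict (Icc 0 1)) :=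
    MemLp.of_bound hc.aestronglyMeasurable C
      ((ae_restrict_mem measurableSet_Icc).mono fun s hs => hC s hs)
  rw [← memLp_indicator_iff_restrict measurableSet_Icc] at h1
  refine (memLp_congr_ae ?_).1 (h1.restrict (Ioi 0))
  filter_upwards [ae_restrict_mem measurableSet_Ioi] with s hs
  rw [indicator_apply]
  split_ifs with h
  · rfl
  have hs1 : 1 < s := not_le.1 fun h' => h ⟨(mem_Ioi.1 hs).le, h'⟩
  have : φ =ᶠ[nhds s] fun _ => 0 := by
    filter_upwards [Ioi_mem_nhds hs1] with t ht using hφzero t (mem_Ioi.1 ht).le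
  rw [this.deriv_eq, deriv_const, Complex.ofReal_zero]

lemma primitive_deriv_cutoff {φ : ℝ → ℝ} (hφ : ContDiff ℝ (⊤ : ℕ∞) φ) (h0 : φ 0 = 1) (s : ℝ) :
    ∫ t in (0 : ℝ)..s, ((deriv φ t : ℝ) : ℂ) = (φ s : ℂ) - 1 := by
  rw [intervalIntegral.integral_ofReal, intervalIntegral.integral_deriv_eq_sub
    (fun t _ => (hφ.differentiable (by simp)).differentiableAt)
    ((hφ.continuous_deriv (by simp)).intervalIntegrable _ _), h0]
  push_cast
  rfl

/-- `K_α - λ` on `W¹`, in terms of the splitting `f = a + p` with `p` in the weighted space. -/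
lemma cornerOp_sub_eq_of_eq_const_add {α : ℝ} (hα0 : 0 < α) (hαπ : α < Real.pi) {lam a : ℂ}
    {f p : ℝ → ℂ} (hp : MemLp (toLine p) 2) (hf : ∀ t, 0 < t → f t = a + p t) {s : ℝ}
    (hs : 0 < s) :
    cornerOp α f s - lam * f s = a * (((1 - α / Real.pi : ℝ) : ℂ) - lam) +
      (cornerOp α p s - lam * p s) := by
  have h : cornerOp α f s = cornerOp α (fun t => a + p t) s :=
    setIntegral_congr_fun measurableSet_Ioi fun t ht => by simp only [hf t ht]
  rw [h, cornerOp_const_add hα0 hαπ a hp hs, hf s hs]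
  ring

lemma primitive_mul_add {u v : ℝ → ℂ} (hu : MemLp u 2 (volume.restrict (Ioi 0)))
    (hv : MemLp v 2 (volume.restrict (Ioi 0))) (c : ℂ) {s : ℝ} (hs : 0 < s) :
    ∫ t in (0 : ℝ)..s, (c * v t + u t) =
      c * (∫ t in (0 : ℝ)..s, v t) + ∫ t in (0 : ℝ)..s, u t := by
  rw [intervalIntegral.integral_add ((intervalIntegrable_of_memLp hv le_rfl hs.le).const_mul c)
    (intervalIntegrable_of_memLp hu le_rfl hs.le), intervalIntegral.integral_const_mul]

end

/-- Lemma 3.7, case `η = 1`: if `λ` avoids the closure of the symbol curve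
`{K̂_α(−1/2 + it) : t ∈ ℝ}` and `λ ≠ 1 − α/π`, then for every
`g = bφ + g₀ ∈ W¹((0,∞)) = ℂφ ⊕ W₀¹((0,∞))` there is a unique `f = aφ + h ∈ W¹((0,∞))`
with `(K_α − λ)f = g` a.e. on `(0,∞)`.
Local absolute continuity with a.e. derivative `h'` is encoded by the fundamental theorem of
calculus condition `h(b) − h(a) = ∫_a^b h'` for all `0 < a ≤ b`. -/
theorem corner_operator_invertible_W1 (α : ℝ) (hα0 : 0 < α) (hαπ : α < Real.pi)
    (φ : ℝ → ℝ) (hφsmooth : ContDiff ℝ (⊤ : ℕ∞) φ) (hφmono : AntitoneOn φ (Ici 0))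
    (hφone : ∃ δ > 0, ∀ s ∈ Icc (0 : ℝ) δ, φ s = 1)
    (hφzero : ∀ s : ℝ, 1 ≤ s → φ s = 0)
    (lam : ℂ)
    (hlam1 : lam ∉ closure (Set.range (fun t : ℝ =>
      Complex.sin (((Real.pi - α : ℝ) : ℂ) * (((-(1 / 2) : ℝ) : ℂ) + (t : ℂ) * Complex.I)) /
        Complex.sin ((Real.pi : ℂ) * (((-(1 / 2) : ℝ) : ℂ) + (t : ℂ) * Complex.I)))))
    (hlam2 : lam ≠ ((1 - α / Real.pi : ℝ) : ℂ))
    (b : ℂ) (g₀ g₀' : ℝ → ℂ)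
    (hg₀lac : ∀ a c : ℝ, 0 < a → a ≤ c → g₀ c - g₀ a = ∫ s in a..c, g₀' s)
    (hg₀w : IntegrableOn (fun s : ℝ => ‖g₀ s‖ ^ 2 / s ^ 2) (Ioi 0))
    (hg₀d : IntegrableOn (fun s : ℝ => ‖g₀' s‖ ^ 2) (Ioi 0)) :
    ∃ a : ℂ, ∃ h h' : ℝ → ℂ,
      ((∀ x y : ℝ, 0 < x → x ≤ y → h y - h x = ∫ s in x..y, h' s) ∧
        IntegrableOn (fun s : ℝ => ‖h s‖ ^ 2 / s ^ 2) (Ioi 0) ∧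
        IntegrableOn (fun s : ℝ => ‖h' s‖ ^ 2) (Ioi 0) ∧
        (∀ᵐ s ∂(volume.restrict (Ioi (0 : ℝ))),
          (∫ t in Ioi (0 : ℝ),
            ((s * Real.sin α / (Real.pi * (s ^ 2 - 2 * s * t * Real.cos α + t ^ 2)) : ℝ) : ℂ)
              * (a * (φ t : ℂ) + h t))
            - lam * (a * (φ s : ℂ) + h s) = b * (φ s : ℂ) + g₀ s)) ∧
      (∀ a₂ : ℂ, ∀ h₂ h₂' : ℝ → ℂ,
        (∀ x y : ℝ, 0 < x → x ≤ y → h₂ y - h₂ x = ∫ s in x..y, h₂' s) →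
        IntegrableOn (fun s : ℝ => ‖h₂ s‖ ^ 2 / s ^ 2) (Ioi 0) →
        IntegrableOn (fun s : ℝ => ‖h₂' s‖ ^ 2) (Ioi 0) →
        (∀ᵐ s ∂(volume.restrict (Ioi (0 : ℝ))),
          (∫ t in Ioi (0 : ℝ),
            ((s * Real.sin α / (Real.pi * (s ^ 2 - 2 * s * t * Real.cos α + t ^ 2)) : ℝ) : ℂ)
              * (a₂ * (φ t : ℂ) + h₂ t))
            - lam * (a₂ * (φ s : ℂ) + h₂ s) = b * (φ s : ℂ) + g₀ s) →
        a₂ = a ∧ ∀ s ∈ Ioi (0 : ℝ), h₂ s = h s) := by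
  have hφ0 : φ 0 = 1 := by
    obtain ⟨δ, hδ, h⟩ := hφone
    exact h 0 ⟨le_rfl, hδ.le⟩
  set v : ℝ → ℂ := fun s => ((deriv φ s : ℝ) : ℂ)
  have hv : MemLp v 2 (volume.restrict (Ioi 0)) := memLp_deriv_cutoff hφsmooth hφzero
  have hvφ : ∀ s, ∫ t in (0 : ℝ)..s, v t = (φ s : ℂ) - 1 := primitive_deriv_cutoff hφsmooth hφ0
  obtain ⟨δ, hδ, hsym⟩ := exists_le_norm_fourier_cornerKernel_sub hα0 hαπ hlam1
  obtain ⟨u, hu, hgu⟩ := exists_memLp_eq_primitive hg₀lac hg₀w hg₀d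
  obtain ⟨w, hw, hweq⟩ := exists_cornerOp_primitive_eq hα0 hαπ hδ hsym ((hv.const_mul b).add hu)
  have hne : ((1 - α / Real.pi : ℝ) : ℂ) - lam ≠ 0 := sub_ne_zero.2 hlam2.symm
  set a : ℂ := b / (((1 - α / Real.pi : ℝ) : ℂ) - lam) with ha
  have hab : a * (((1 - α / Real.pi : ℝ) : ℂ) - lam) = b := div_mul_cancel₀ _ hne
  have hh' : MemLp (fun t => -a * v t + w t) 2 (volume.restrict (Ioi 0)) :=
    (hv.const_mul (-a)).add hw
  have hsplit : ∀ t, 0 < t → a * (φ t : ℂ) + ∫ r in (0 : ℝ)..t, (-a * v r + w r) =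
      a + ∫ r in (0 : ℝ)..t, w r := fun t ht => by
    rw [primitive_mul_add hw hv _ ht, hvφ]
    ring
  have hwL := memLp_toLine_primitive hw
  refine ⟨a, fun s => ∫ t in (0 : ℝ)..s, (-a * v t + w t), fun t => -a * v t + w t,
    ⟨fun x y hx hxy => ?_, ?_, (memLp_two_iff_integrable_sq_norm hh'.1).1 hh', ?_⟩, ?_⟩
  · exact intervalIntegral.integral_interval_sub_left
      (intervalIntegrable_of_memLp hh' le_rfl (hx.le.trans hxy))
      (intervalIntegrable_of_memLp hh' le_rfl hx.le)
  · have h1 := memLp_toLine_iff.1 (memLp_toLine_primitive hh')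
    have h2 := (memLp_two_iff_integrable_sq_norm h1.1).1 h1
    simp only [norm_div, div_pow, Complex.norm_real, Real.norm_eq_abs, sq_abs] at h2
    exact h2
  · filter_upwards [hweq, ae_restrict_mem measurableSet_Ioi] with s hs hs0
    refine (cornerOp_sub_eq_of_eq_const_add hα0 hαπ hwL hsplit hs0).trans ?_
    rw [hs, hab, hgu s hs0]
    refine (congrArg (b + ·) (primitive_mul_add hu hv b hs0)).trans ?_
    rw [hvφ]
    ring
  · intro a₂ h₂ h₂' hlac₂ hw₂ hd₂ heq₂
    obtain ⟨u₂, hu₂, hgu₂⟩ := exists_memLp_eq_primitive hlac₂ hw₂ hd₂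
    have hP₂ : MemLp (fun t => a₂ * v t + u₂ t) 2 (volume.restrict (Ioi 0)) :=
      (hv.const_mul a₂).add hu₂
    have hP₂L := memLp_toLine_primitive hP₂
    have hsplit₂ : ∀ t, 0 < t → a₂ * (φ t : ℂ) + h₂ t =
        a₂ + ∫ r in (0 : ℝ)..t, (a₂ * v r + u₂ r) := fun t ht => by
      rw [primitive_mul_add hu₂ hv _ ht, hvφ, hgu₂ t ht]
      ring
    obtain ⟨hc, hp⟩ := eq_zero_of_const_add_cornerOp_sub hα0 hαπ (lam := lam)
      (fun ξ hξ => by simpa [hξ] using hδ.trans_le (hsym ξ))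
      (c := (a₂ - a) * (((1 - α / Real.pi : ℝ) : ℂ) - lam))
      (p := fun s => (∫ r in (0 : ℝ)..s, (a₂ * v r + u₂ r)) - ∫ r in (0 : ℝ)..s, w r)
      (by
        convert! hP₂L.sub hwL using 1
        ext x
        simp only [toLine, Pi.sub_apply, mul_sub])
      (by
        filter_upwards [hweq, heq₂, ae_restrict_mem measurableSet_Ioi] with s hs hs₂ hs0
        have e₂ := (cornerOp_sub_eq_of_eq_const_add (lam := lam) hα0 hαπ hP₂L
          hsplit₂ hs0).symm.trans hs₂
        have e₁ := hs.trans (primitive_mul_add hu hv b hs0)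
        rw [hvφ, ← hgu s hs0] at e₁
        rw [cornerOp_sub hα0 hαπ hP₂L hwL hs0]
        linear_combination e₂ - e₁ - hab)
    have haa : a₂ = a := sub_eq_zero.1 ((mul_eq_zero.1 hc).resolve_right hne)
    refine ⟨haa, fun s hs => ?_⟩
    have hEq := Measure.eqOn_open_of_ae_eq hp isOpen_Ioi
      ((continuousOn_primitive_Ioi hP₂).sub (continuousOn_primitive_Ioi hw)) continuousOn_const hs
    have e₁ := hsplit s hs
    have e₂ := hsplit₂ s hs
    simp only [Pi.zero_apply] at hEq
    rw [haa] at e₂ hEq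
    linear_combination e₂ - e₁ + hEq
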